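/- Let Φ be a root system in V, let ω ∈ V be regular for Φ, and let s : Φ → ℝ be a function with s(α) > 0 for all α ∈ Φ and which is invariant under the Weyl group, i.e. s(s_β(α)) = s(α) for all α, β ∈ Φ. Then the set S⁺ = {α ∈ Φ : ⟨ω, α⟩ = s(α)} is linearly independent in V. -/

import Mathlib

open scoped RealInnerProductSpace

/-- The reflection associated to a vector `α` in a real inner product space:
`s_α (x) = x - (2⟪x,α⟫/⟪α,α⟫) α`. -/
noncomputable def sRefl {V : Type*} [NormedAddCommGroup V] [InnerProductSpace ℝ V]
    (α : V) (x : V) : V :=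
  x - (2 * ⟪x, α⟫ / ⟪α, α⟫) • α

/-- A (reduced, crystallographic) root system in a real inner product space `V`. -/
structure IsRootSystem {V : Type*} [NormedAddCommGroup V] [InnerProductSpace ℝ V]
    (Φ : Finset V) : Prop where
  zero_not_mem : (0 : V) ∉ Φ
  refl_mem : ∀ α ∈ Φ, ∀ β ∈ Φ, sRefl α β ∈ Φ
  crystallographic : ∀ α ∈ Φ, ∀ β ∈ Φ, ∃ n : ℤ, 2 * ⟪β, α⟫ / ⟪α, α⟫ = (n : ℝ)
  reduced : ∀ α ∈ Φ, ∀ c : ℝ, c • α ∈ Φ → c = 1 ∨ c = -1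


section TwoLength

variable {V : Type*} [NormedAddCommGroup V] [InnerProductSpace ℝ V]

/-- A two-length (ratio two) system of vectors with a regular functional. -/
structure TwoLen (Sh Lo : Set V) (a : ℝ) (ω : V) (ks kl : ℝ) : Prop where
  finS : Sh.Finite
  finL : Lo.Finite
  apos : 0 < a
  kspos : 0 < ks
  klpos : 0 < kl
  nS : ∀ x ∈ Sh, ⟪x, x⟫ = a
  nL : ∀ x ∈ Lo, ⟪x, x⟫ = 2 * a
  pss : ∀ x ∈ Sh, ∀ y ∈ Sh, ⟪x, y⟫ = 0 ∨ ⟪x, y⟫ = a / 2 ∨ ⟪x, y⟫ = -(a / 2) ∨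
    ⟪x, y⟫ = a ∨ ⟪x, y⟫ = -a
  pll : ∀ x ∈ Lo, ∀ y ∈ Lo, ⟪x, y⟫ = 0 ∨ ⟪x, y⟫ = a ∨ ⟪x, y⟫ = -a ∨
    ⟪x, y⟫ = 2 * a ∨ ⟪x, y⟫ = -(2 * a)
  psl : ∀ x ∈ Sh, ∀ y ∈ Lo, ⟪x, y⟫ = 0 ∨ ⟪x, y⟫ = a ∨ ⟪x, y⟫ = -a
  rSS : ∀ x ∈ Sh, ∀ y ∈ Sh, x - (2 * ⟪x, y⟫ / a) • y ∈ Sh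
  rSL : ∀ x ∈ Sh, ∀ y ∈ Lo, x - (⟪x, y⟫ / a) • y ∈ Sh
  rLS : ∀ x ∈ Lo, ∀ y ∈ Sh, x - (2 * ⟪y, x⟫ / a) • y ∈ Lo
  rLL : ∀ x ∈ Lo, ∀ y ∈ Lo, x - (⟪x, y⟫ / a) • y ∈ Lo
  regS : ∀ x ∈ Sh, ⟪ω, x⟫ ≠ 0
  regL : ∀ x ∈ Lo, ⟪ω, x⟫ ≠ 0

namespace TwoLen

variable {Sh Lo : Set V} {a : ℝ} {ω : V} {ks kl : ℝ}

theorem vec_eq_of {x y : V} (h : ⟪x, x⟫ - 2 * ⟪x, y⟫ + ⟪y, y⟫ = 0) : x = y := by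
  have : ⟪x - y, x - y⟫ = 0 := by
    rw [real_inner_sub_sub_self]; exact h
  exact sub_eq_zero.1 (inner_self_eq_zero.1 this)

theorem dual (T : TwoLen Sh Lo a ω ks kl) :
    TwoLen Lo ((fun x : V => (2 : ℝ) • x) '' Sh) (2 * a) ω kl (2 * ks) where
  finS := T.finL
  finL := T.finS.image _
  apos := by have := T.apos; linarith
  kspos := T.klpos
  klpos := by have := T.kspos; linarith
  nS := T.nL
  nL := by
    rintro _ ⟨x, hx, rfl⟩
    have := T.nS x hx
    simp only [real_inner_smul_left, real_inner_smul_right]; linarith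
  pss := by
    intro x hx y hy
    rcases T.pll x hx y hy with h | h | h | h | h <;> rw [h]
    · left; rfl
    · right; left; ring
    · right; right; left; ring
    · right; right; right; left; ring
    · right; right; right; right; ring
  pll := by
    rintro _ ⟨x, hx, rfl⟩ _ ⟨y, hy, rfl⟩
    simp only [real_inner_smul_left, real_inner_smul_right]
    rcases T.pss x hx y hy with h | h | h | h | h <;> rw [h]
    · left; ring
    · right; left; ring
    · right; right; left; ring
    · right; right; right; left; ring
    · right; right; right; right; ring
  psl := by
    rintro x hx _ ⟨y, hy, rfl⟩
    simp only [real_inner_smul_right]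
    rw [real_inner_comm]
    rcases T.psl y hy x hx with h | h | h <;> rw [h]
    · left; ring
    · right; left; ring
    · right; right; ring
  rSS := by
    intro x hx y hy
    have := T.rLL x hx y hy
    rwa [mul_div_mul_left _ _ (two_ne_zero)]
  rSL := by
    rintro x hx _ ⟨y, hy, rfl⟩
    have := T.rLS x hx y hy
    have e : (⟪x, (2 : ℝ) • y⟫ / (2 * a)) • (2 : ℝ) • y = (2 * ⟪y, x⟫ / a) • y := by
      rw [smul_smul, real_inner_smul_right, real_inner_comm, mul_div_mul_left _ _ (two_ne_zero)]
      congr 1; ring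
    simp only [e]; exact this
  rLS := by
    rintro _ ⟨x, hx, rfl⟩ y hy
    refine ⟨_, T.rSL x hx y hy, ?_⟩
    simp only [smul_sub, smul_smul, real_inner_smul_right]
    rw [real_inner_comm x y]
    congr 2
    have := T.apos
    field_simp
  rLL := by
    rintro _ ⟨x, hx, rfl⟩ _ ⟨y, hy, rfl⟩
    refine ⟨_, T.rSS x hx y hy, ?_⟩
    simp only [smul_sub, smul_smul, real_inner_smul_right, real_inner_smul_left]
    congr 2
    have := T.apos
    field_simp
    try ring
  regS := T.regL
  regL := by
    rintro _ ⟨x, hx, rfl⟩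
    have := T.regS x hx
    simp only [real_inner_smul_right]
    positivity

section basic
variable (T : TwoLen Sh Lo a ω ks kl)
include T

theorem negS {x : V} (hx : x ∈ Sh) : -x ∈ Sh := by
  have h := T.rSS x hx x hx
  have := T.apos
  rw [T.nS x hx, mul_div_assoc, div_self this.ne'] at h
  convert h using 1
  module

theorem negL {x : V} (hx : x ∈ Lo) : -x ∈ Lo := by
  have h := T.rLL x hx x hx
  have := T.apos
  rw [T.nL x hx, mul_div_assoc, div_self this.ne'] at h
  convert h using 1
  module

theorem coefS (c : ℝ) : 2 * (c * a) / a = 2 * c := by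
  have := T.apos
  field_simp

/-- Two distinct short elements of the level set are orthogonal or at angle 120 degrees. -/
theorem F1 {x y : V} (hx : x ∈ Sh) (hy : y ∈ Sh) (hωx : ⟪ω, x⟫ = ks) (hωy : ⟪ω, y⟫ = ks)
    (hne : x ≠ y) : ⟪x, y⟫ = 0 ∨ ⟪x, y⟫ = -(a / 2) := by
  have ha := T.apos
  have hk := T.kspos
  have hxx := T.nS x hx
  have hyy := T.nS y hy
  rcases T.pss x hx y hy with h | h | h | h | h
  · exact Or.inl h
  · exfalso
    have h1 := T.rSS x hx y hy
    have e : 2 * (a / 2) / a = 1 := by field_simp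
    rw [h, e, one_smul] at h1
    apply T.regS _ h1
    rw [inner_sub_right, hωx, hωy, sub_self]
  · exact Or.inr h
  · exact absurd (vec_eq_of (by rw [h, hxx, hyy]; ring)) hne
  · exfalso
    have : x = -y := vec_eq_of (by
      simp only [inner_neg_right, inner_neg_left]; rw [h, hxx, hyy]; ring)
    rw [this, inner_neg_right] at hωx
    linarith

theorem F2 {x y b : V} (hx : x ∈ Sh) (hy : y ∈ Sh) (hωx : ⟪ω, x⟫ = ks) (hωy : ⟪ω, y⟫ = ks)
    (hxy : ⟪x, y⟫ = 0) (hb : b ∈ Lo) (hxb : ⟪x, b⟫ ≠ 0) : ⟪y, b⟫ = 0 := by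
  have ha := T.apos
  have hxx := T.nS x hx
  have hyy := T.nS y hy
  have hbb := T.nL b hb
  by_contra hyb
  have h2 := T.rLS b hb y hy
  rcases (T.psl x hx b hb).resolve_left hxb with h | h <;>
  rcases (T.psl y hy b hb).resolve_left hyb with h' | h'
  · have e : b = x + y := vec_eq_of (by
      simp only [inner_add_right, inner_add_left, real_inner_comm x b, real_inner_comm y b,
        real_inner_comm x y, h, h', hxy, hxx, hyy, hbb]; ring)
    have e2 : 2 * a / a = 2 := by field_simp
    rw [h', e2, e] at h2
    apply T.regL _ h2
    simp only [inner_sub_right, inner_add_right, real_inner_smul_right, hωx, hωy]; ring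
  · have e : b = x - y := vec_eq_of (by
      simp only [inner_sub_right, inner_sub_left, real_inner_comm x b, real_inner_comm y b,
        real_inner_comm x y, h, h', hxy, hxx, hyy, hbb]; ring)
    apply T.regL _ hb
    rw [e, inner_sub_right, hωx, hωy, sub_self]
  · have e : b = y - x := vec_eq_of (by
      simp only [inner_sub_right, inner_sub_left, real_inner_comm x b, real_inner_comm y b,
        real_inner_comm x y, h, h', hxy, hxx, hyy, hbb]; ring)
    apply T.regL _ hb
    rw [e, inner_sub_right, hωx, hωy, sub_self]
  · have e : b = - x - y := vec_eq_of (by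
      simp only [inner_sub_right, inner_sub_left, inner_neg_left, inner_neg_right,
        real_inner_comm x b, real_inner_comm y b,
        real_inner_comm x y, h, h', hxy, hxx, hyy, hbb]; ring)
    have e2 : 2 * -a / a = -2 := by field_simp
    rw [h', e2, e] at h2
    apply T.regL _ h2
    simp only [inner_sub_right, inner_neg_right, real_inner_smul_right, hωx, hωy]; ring

theorem F4 {x y b b' : V} (hx : x ∈ Sh) (hy : y ∈ Sh) (hωx : ⟪ω, x⟫ = ks) (hωy : ⟪ω, y⟫ = ks)
    (hxy : ⟪x, y⟫ = 0) (hb : b ∈ Lo) (hxb : ⟪x, b⟫ ≠ 0) (hb' : b' ∈ Lo) (hyb' : ⟪y, b'⟫ ≠ 0) :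
    ⟪b, b'⟫ = 0 := by
  have ha := T.apos
  have h1 : ⟪y, b⟫ = 0 := T.F2 hx hy hωx hωy hxy hb hxb
  have h2 : ⟪x, b'⟫ = 0 := T.F2 hy hx hωy hωx (by rw [real_inner_comm]; exact hxy) hb' hyb'
  have h3 := T.rLL b hb b' hb'
  have h4 := T.F2 hx hy hωx hωy hxy h3 (by
    simp only [inner_sub_right, real_inner_smul_right, h2]; simpa using hxb)
  simp only [inner_sub_right, real_inner_smul_right, h1] at h4
  have : ⟪b, b'⟫ / a * ⟪y, b'⟫ = 0 := by linarith
  rcases mul_eq_zero.1 this with h | h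
  · exact (div_eq_zero_iff.1 h).resolve_right ha.ne'
  · exact absurd h hyb'

/-- orthogonality to all long neighbours of `y` propagates along non-orthogonality. -/
theorem F5 {y t t' : V} (ht : ∀ b ∈ Lo, ⟪y, b⟫ ≠ 0 → ⟪t, b⟫ = 0)
    (ht' : t' ∈ Lo) (htt' : ⟪t, t'⟫ ≠ 0) : ∀ b ∈ Lo, ⟪y, b⟫ ≠ 0 → ⟪t', b⟫ = 0 := by
  intro b hb hyb
  have ha := T.apos
  by_contra hc
  have h0 : ⟪y, t'⟫ = 0 := by
    by_contra h; exact htt' (ht t' ht' h)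
  have h1 := T.rLL b hb t' ht'
  have h2 := ht _ h1 (by simp only [inner_sub_right, real_inner_smul_right, h0]; simpa using hyb)
  simp only [inner_sub_right, real_inner_smul_right, ht b hb hyb] at h2
  have : ⟪b, t'⟫ / a * ⟪t, t'⟫ = 0 := by linarith
  rcases mul_eq_zero.1 this with h | h
  · rw [real_inner_comm] at h
    exact hc ((div_eq_zero_iff.1 h).resolve_right ha.ne')
  · exact htt' h

end basic

section basic2
variable (T : TwoLen Sh Lo a ω ks kl)
include T

theorem F1' {x y : V} (hx : x ∈ Lo) (hy : y ∈ Lo) (hωx : ⟪ω, x⟫ = kl) (hωy : ⟪ω, y⟫ = kl)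
    (hne : x ≠ y) : ⟪x, y⟫ = 0 ∨ ⟪x, y⟫ = -a := by
  rcases T.dual.F1 hx hy hωx hωy hne with h | h
  · exact Or.inl h
  · right; rw [h]; ring

theorem F6 {x y b : V} (hx : x ∈ Sh) (hy : y ∈ Sh) (hωx : ⟪ω, x⟫ = ks) (hωy : ⟪ω, y⟫ = ks)
    (hne : x ≠ y) (hb : b ∈ Lo) (hxb : ⟪x, b⟫ = a) :
    (⟪x, y⟫ = 0 ∧ ⟪y, b⟫ = 0) ∨ (⟪x, y⟫ = -(a / 2) ∧ (⟪y, b⟫ = 0 ∨ ⟪y, b⟫ = -a)) := by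
  have ha := T.apos
  rcases T.F1 hx hy hωx hωy hne with h | h
  · exact Or.inl ⟨h, T.F2 hx hy hωx hωy h hb (by rw [hxb]; exact ha.ne')⟩
  · refine Or.inr ⟨h, ?_⟩
    rcases T.psl y hy b hb with h' | h' | h'
    · exact Or.inl h'
    · exfalso
      have h1 := T.rSS x hx y hy
      have e : 2 * -(a / 2) / a = -1 := by field_simp
      rw [h, e] at h1
      have h2 := T.psl _ h1 b hb
      simp only [inner_sub_left, real_inner_smul_left, hxb, h'] at h2
      rcases h2 with h2 | h2 | h2 <;> linarith
    · exact Or.inr h'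

theorem F6' {x y b : V} (hx : x ∈ Lo) (hy : y ∈ Lo) (hωx : ⟪ω, x⟫ = kl) (hωy : ⟪ω, y⟫ = kl)
    (hne : x ≠ y) (hb : b ∈ Sh) (hxb : ⟪b, x⟫ = a) :
    (⟪x, y⟫ = 0 ∧ ⟪b, y⟫ = 0) ∨ (⟪x, y⟫ = -a ∧ (⟪b, y⟫ = 0 ∨ ⟪b, y⟫ = -a)) := by
  have h := T.dual.F6 hx hy hωx hωy hne (b := (2 : ℝ) • b) ⟨b, hb, rfl⟩
    (by rw [real_inner_smul_right, real_inner_comm, hxb])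
  simp only [real_inner_smul_right, real_inner_comm b y] at h
  rcases h with ⟨h1, h2⟩ | ⟨h1, h2⟩
  · left; exact ⟨h1, by linarith⟩
  · right; refine ⟨by linarith, ?_⟩
    rcases h2 with h2 | h2
    · left; linarith
    · right; linarith

/-- the long root `2x - b` -/
theorem delta_mem {x b : V} (hx : x ∈ Sh) (hb : b ∈ Lo) (hxb : ⟪x, b⟫ = a) :
    (2 : ℝ) • x - b ∈ Lo := by
  have ha := T.apos
  have h := T.negL (T.rLS b hb x hx)
  have e : 2 * a / a = 2 := by field_simp
  rw [hxb, e] at h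
  convert h using 1
  module

theorem F7 {x y z b b' : V} (hx : x ∈ Sh) (hy : y ∈ Sh) (hz : z ∈ Sh)
    (hωx : ⟪ω, x⟫ = ks) (hωy : ⟪ω, y⟫ = ks) (hωz : ⟪ω, z⟫ = ks)
    (hxy : x ≠ y) (hxz : x ≠ z) (hyz : y ≠ z)
    (hb : b ∈ Lo) (hb' : b' ∈ Lo) (hωb : ⟪ω, b⟫ = kl) (hωb' : ⟪ω, b'⟫ = kl) (hbb' : b ≠ b')
    (hxb : ⟪x, b⟫ = a) (ixy : ⟪x, y⟫ ≠ 0) (ixz : ⟪x, z⟫ ≠ 0) (ibb' : ⟪b, b'⟫ ≠ 0) : False := by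
  have ha := T.apos
  have hk := T.kspos
  have hxx := T.nS x hx
  have hyy := T.nS y hy
  have hzz := T.nS z hz
  obtain ⟨jxy, jyb⟩ := (T.F6 hx hy hωx hωy hxy hb hxb).resolve_left (fun h => ixy h.1)
  obtain ⟨jxz, jzb⟩ := (T.F6 hx hz hωx hωz hxz hb hxb).resolve_left (fun h => ixz h.1)
  obtain ⟨jbb', jxb'⟩ := (T.F6' hb hb' hωb hωb' hbb' hx hxb).resolve_left (fun h => ibb' h.1)
  have jyz : ⟪y, z⟫ = 0 := by
    rcases T.F1 hy hz hωy hωz hyz with h | h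
    · exact h
    · exfalso
      have e : x = -y - z := vec_eq_of (by
        simp only [inner_sub_right, inner_sub_left, inner_neg_left, inner_neg_right,
          real_inner_comm y z, jxy, jxz, h, hxx, hyy, hzz]; ring)
      rw [e, inner_sub_right, inner_neg_right, hωy, hωz] at hωx
      linarith
  have jzy : ⟪z, y⟫ = 0 := by rw [real_inner_comm]; exact jyz
  have hd := T.delta_mem hx hb hxb
  have dy : ⟪y, (2 : ℝ) • x - b⟫ = -a - ⟪y, b⟫ := by
    rw [inner_sub_right, real_inner_smul_right, real_inner_comm, jxy]; ring
  have dz : ⟪z, (2 : ℝ) • x - b⟫ = -a - ⟪z, b⟫ := by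
    rw [inner_sub_right, real_inner_smul_right, real_inner_comm, jxz]; ring
  have db' : ⟪b', (2 : ℝ) • x - b⟫ ≠ 0 := by
    rw [inner_sub_right, real_inner_smul_right, real_inner_comm, real_inner_comm b b', jbb']
    rcases jxb' with h | h <;> rw [h] <;> intro h <;> linarith
  have key : ∀ u v : V, u ∈ Sh → v ∈ Sh → ⟪ω, u⟫ = ks → ⟪ω, v⟫ = ks → ⟪u, v⟫ = 0 →
      ⟪u, b⟫ ≠ 0 → ⟪v, (2 : ℝ) • x - b⟫ ≠ 0 → False := by
    intro u v hu hv hωu hωv huv hub hvd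
    exact db' (T.F5 (fun c hc hvc => T.F4 hu hv hωu hωv huv hb hub hc hvc) hb' ibb' _ hd hvd)
  rcases jyb with h | h <;> rcases jzb with h' | h'
  · have := T.F2 hy hz hωy hωz jyz hd (by rw [dy, h]; intro h; linarith)
    rw [dz, h'] at this; linarith
  · exact key z y hz hy hωz hωy jzy (by rw [h']; intro h; linarith)
      (by rw [dy, h]; intro h; linarith)
  · exact key y z hy hz hωy hωz jyz (by rw [h]; intro h; linarith)
      (by rw [dz, h']; intro h; linarith)
  · have := T.F2 hy hz hωy hωz jyz hb (by rw [h]; intro h; linarith)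
    linarith

theorem F8 {x y z b b' : V} (hx : x ∈ Sh) (hy : y ∈ Sh) (hz : z ∈ Sh)
    (hωx : ⟪ω, x⟫ = ks) (hωy : ⟪ω, y⟫ = ks) (hωz : ⟪ω, z⟫ = ks)
    (hxy : x ≠ y) (hyz : y ≠ z)
    (hb : b ∈ Lo) (hb' : b' ∈ Lo) (hωb : ⟪ω, b⟫ = kl) (hωb' : ⟪ω, b'⟫ = kl) (hbb' : b ≠ b')
    (hxb : ⟪x, b⟫ = a) (ixy : ⟪x, y⟫ ≠ 0) (ixz : ⟪x, z⟫ = 0) (ibb' : ⟪b, b'⟫ ≠ 0) :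
    ⟪y, z⟫ = 0 := by
  have ha := T.apos
  by_contra iyz
  obtain ⟨jxy, jyb⟩ := (T.F6 hx hy hωx hωy hxy hb hxb).resolve_left (fun h => ixy h.1)
  obtain ⟨jbb', jxb'⟩ := (T.F6' hb hb' hωb hωb' hbb' hx hxb).resolve_left (fun h => ibb' h.1)
  have jyz := (T.F1 hy hz hωy hωz hyz).resolve_left iyz
  have hd := T.delta_mem hx hb hxb
  have dy : ⟪y, (2 : ℝ) • x - b⟫ = -a - ⟪y, b⟫ := by
    rw [inner_sub_right, real_inner_smul_right, real_inner_comm, jxy]; ring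
  have dx : ⟪x, (2 : ℝ) • x - b⟫ = a := by
    rw [inner_sub_right, real_inner_smul_right, hxb, T.nS x hx]; ring
  have db' : ⟪b', (2 : ℝ) • x - b⟫ = 2 * ⟪x, b'⟫ + a := by
    rw [inner_sub_right, real_inner_smul_right, real_inner_comm, real_inner_comm b b', jbb']
    ring
  have key : ∀ ξ ∈ Lo, ⟪x, ξ⟫ = a → ⟪y, ξ⟫ = -a → (⟪b', ξ⟫ = a ∨ ⟪b', ξ⟫ = -a) → False := by
    intro ξ hξ hxξ hyξ hb'ξ
    have hη := T.rLS ξ hξ y hy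
    have e : 2 * -a / a = -2 := by field_simp
    rw [hyξ, e] at hη
    have hzξ : ⟪z, ξ⟫ = 0 := T.F2 hx hz hωx hωz ixz hξ (by rw [hxξ]; exact ha.ne')
    have hzη : ⟪z, ξ - (-2 : ℝ) • y⟫ = -a := by
      rw [inner_sub_right, real_inner_smul_right, hzξ, real_inner_comm, jyz]; ring
    have h1 := T.F5 (fun c hc hzc => T.F4 hx hz hωx hωz ixz hξ (by rw [hxξ]; exact ha.ne') hc hzc)
      hb' (by rw [real_inner_comm]; rcases hb'ξ with h | h <;> rw [h] <;> intro h <;> linarith)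
      _ hη (by rw [hzη]; intro h; linarith)
    rw [inner_sub_right, real_inner_smul_right, real_inner_comm y b'] at h1
    rcases T.psl y hy b' hb' with h | h | h <;> rcases hb'ξ with h' | h' <;>
      rw [h, h'] at h1 <;> linarith
  rcases jyb with h | h
  · apply key _ hd dx (by rw [dy, h]; ring)
    rw [db']
    rcases jxb' with h | h <;> rw [h]
    · left; ring
    · right; ring
  · apply key _ hb hxb h
    right; rw [real_inner_comm]; exact jbb'

theorem F9 {x y z b b' : V} (hx : x ∈ Sh) (hy : y ∈ Sh) (hz : z ∈ Sh)
    (hωx : ⟪ω, x⟫ = ks) (hωy : ⟪ω, y⟫ = ks) (hωz : ⟪ω, z⟫ = ks)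
    (hxy : x ≠ y) (hxz : x ≠ z) (hyz : y ≠ z)
    (hb : b ∈ Lo) (hb' : b' ∈ Lo) (hωb : ⟪ω, b⟫ = kl) (hωb' : ⟪ω, b'⟫ = kl) (hbb' : b ≠ b')
    (hxb : ⟪x, b⟫ = a) (ixy : ⟪x, y⟫ ≠ 0) (ibb' : ⟪b, b'⟫ ≠ 0) :
    ⟪z, x⟫ = 0 ∧ ⟪z, y⟫ = 0 ∧ ⟪z, b⟫ = 0 ∧ ⟪z, b'⟫ = 0 := by
  have ha := T.apos
  have ixz : ⟪x, z⟫ = 0 := by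
    by_contra ixz
    exact T.F7 hx hy hz hωx hωy hωz hxy hxz hyz hb hb' hωb hωb' hbb' hxb ixy ixz ibb'
  have iyz := T.F8 hx hy hz hωx hωy hωz hxy hyz hb hb' hωb hωb' hbb' hxb ixy ixz ibb'
  have hxb0 : ⟪x, b⟫ ≠ 0 := by rw [hxb]; exact ha.ne'
  refine ⟨by rw [real_inner_comm]; exact ixz, by rw [real_inner_comm]; exact iyz,
    T.F2 hx hz hωx hωz ixz hb hxb0, ?_⟩
  by_contra hc
  have := T.F5 (fun c hc hzc => T.F4 hx hz hωx hωz ixz hb hxb0 hc hzc) hb' ibb' b' hb' hc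
  rw [T.nL b' hb'] at this
  linarith

theorem F9' {x y z b b' : V} (hx : x ∈ Sh) (hy : y ∈ Sh) (hz : z ∈ Lo)
    (hωx : ⟪ω, x⟫ = ks) (hωy : ⟪ω, y⟫ = ks) (hωz : ⟪ω, z⟫ = kl)
    (hxy : x ≠ y) (hbz : b ≠ z) (hb'z : b' ≠ z)
    (hb : b ∈ Lo) (hb' : b' ∈ Lo) (hωb : ⟪ω, b⟫ = kl) (hωb' : ⟪ω, b'⟫ = kl) (hbb' : b ≠ b')
    (hxb : ⟪x, b⟫ = a) (ixy : ⟪x, y⟫ ≠ 0) (ibb' : ⟪b, b'⟫ ≠ 0) :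
    ⟪z, x⟫ = 0 ∧ ⟪z, y⟫ = 0 ∧ ⟪z, b⟫ = 0 ∧ ⟪z, b'⟫ = 0 := by
  have h := T.dual.F9 (b := (2 : ℝ) • x) (b' := (2 : ℝ) • y) hb hb' hz hωb hωb' hωz hbb' hbz hb'z
    ⟨x, hx, rfl⟩ ⟨y, hy, rfl⟩ (by rw [real_inner_smul_right, hωx])
    (by rw [real_inner_smul_right, hωy])
    (fun h => hxy (smul_right_injective V (two_ne_zero (α := ℝ)) h))
    (by rw [real_inner_smul_right, real_inner_comm, hxb]) ibb'
    (by simpa only [real_inner_smul_right, real_inner_smul_left, ne_eq, mul_eq_zero,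
          two_ne_zero, false_or, OfNat.ofNat_ne_zero] using ixy)
  simp only [real_inner_smul_right] at h
  refine ⟨by linarith [h.2.2.1], by linarith [h.2.2.2], h.1, h.2.1⟩

end basic2

theorem orth_span {B : Set V} {u x : V} (h : ∀ b ∈ B, ⟪u, b⟫ = 0)
    (hx : x ∈ Submodule.span ℝ B) : ⟪u, x⟫ = 0 := by
  induction hx using Submodule.span_induction with
  | mem x hx => exact h x hx
  | zero => simp
  | add x y _ _ hx hy => rw [inner_add_right, hx, hy, add_zero]
  | smul c x _ hx => rw [real_inner_smul_right, hx, mul_zero]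

theorem obtuse_span {B : Set V} (hB : ∀ x ∈ B, ∀ y ∈ B, x ≠ y → ⟪x, y⟫ ≤ 0)
    (hω : ∀ x ∈ B, 0 < ⟪ω, x⟫) {g : V} (hg : g ∈ Submodule.span ℝ B)
    (hgB : ∀ b ∈ B, ⟪g, b⟫ ≤ 0) : ⟪ω, g⟫ ≤ 0 := by
  obtain ⟨c, hc, hcg⟩ := (Submodule.mem_span_set).1 hg
  have hcB : ∀ i ∈ c.support, i ∈ B := fun i hi => hc hi
  set p : V := ∑ i ∈ c.support, (max (c i) 0) • i with hp
  set q : V := ∑ i ∈ c.support, (max (-c i) 0) • i with hq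
  have hgpq : g = p - q := by
    rw [← hcg, hp, hq, ← Finset.sum_sub_distrib, Finsupp.sum]
    apply Finset.sum_congr rfl
    intro i _
    rw [← sub_smul]
    congr 1
    rcases le_total (c i) 0 with h | h
    · rw [max_eq_right h, max_eq_left (by linarith)]; ring
    · rw [max_eq_left h, max_eq_right (by linarith)]; ring
  have h1 : ⟪g, p⟫ ≤ 0 := by
    rw [hp, inner_sum]
    apply Finset.sum_nonpos
    intro i hi
    rw [real_inner_smul_right]
    exact mul_nonpos_of_nonneg_of_nonpos (le_max_right _ _) (hgB i (hcB i hi))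
  have h2 : ⟪q, p⟫ ≤ 0 := by
    rw [hp, hq, inner_sum]
    apply Finset.sum_nonpos
    intro j hj
    rw [sum_inner]
    apply Finset.sum_nonpos
    intro i hi
    rw [real_inner_smul_right, real_inner_smul_left, ← mul_assoc]
    by_cases hij : i = j
    · subst hij
      have : max (c i) 0 * max (-c i) 0 = 0 := by
        rcases le_total (c i) 0 with h | h
        · rw [max_eq_right h, zero_mul]
        · rw [max_eq_right (a := -c i) (by linarith), mul_zero]
      rw [this, zero_mul]
    · exact mul_nonpos_of_nonneg_of_nonpos (mul_nonneg (le_max_right _ _) (le_max_right _ _))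
        (hB i (hcB i hi) j (hcB j hj) hij)
  have h3 : ⟪p, p⟫ ≤ 0 := by
    have : ⟪g, p⟫ = ⟪p, p⟫ - ⟪q, p⟫ := by rw [hgpq, inner_sub_left]
    linarith
  have hp0 : p = 0 := inner_self_eq_zero.1 (le_antisymm h3 real_inner_self_nonneg)
  have h4 : 0 ≤ ⟪ω, q⟫ := by
    rw [hq, inner_sum]
    apply Finset.sum_nonneg
    intro i hi
    rw [real_inner_smul_right]
    exact mul_nonneg (le_max_right _ _) (hω i (hcB i hi)).le
  rw [hgpq, hp0, zero_sub, inner_neg_right]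
  linarith

section basic3
variable (T : TwoLen Sh Lo a ω ks kl)
include T

open Classical in
theorem exists_sigma : ∃ σ : V, (∀ b ∈ Lo, ⟪ω, b⟫ = kl → ⟪σ, b⟫ = 2 * a) ∧
    ∀ g ∈ Sh, ∃ m : ℤ, ⟪σ, g⟫ = m * a := by
  have ha := T.apos
  have hk := T.klpos
  set P : Finset V := T.finL.toFinset.filter (fun t => 0 < ⟪ω, t⟫ ∧ ∃ n : ℤ, ⟪ω, t⟫ = n * kl)
    with hP
  have memP : ∀ t, t ∈ P ↔ t ∈ Lo ∧ 0 < ⟪ω, t⟫ ∧ ∃ n : ℤ, ⟪ω, t⟫ = n * kl := by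
    intro t; rw [hP, Finset.mem_filter, Set.Finite.mem_toFinset]
  refine ⟨∑ t ∈ P, t, ?_, ?_⟩
  · intro b hb hωb
    have hbP : b ∈ P := (memP b).2 ⟨hb, by rw [hωb]; exact hk, 1, by rw [hωb]; simp⟩
    have hbb := T.nL b hb
    rw [sum_inner, ← Finset.add_sum_erase _ _ hbP, hbb]
    have refl_inner : ∀ t : V, ⟪t - (⟪t, b⟫ / a) • b, b⟫ = -⟪t, b⟫ := by
      intro t
      rw [inner_sub_left, real_inner_smul_left, hbb]; field_simp; ring
    have : ∑ t ∈ P.erase b, ⟪t, b⟫ = 0 := by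
      apply Finset.sum_involution (fun t _ => t - (⟪t, b⟫ / a) • b)
      · intro t ht
        rw [refl_inner]; ring
      · intro t ht h0 heq
        have := refl_inner t
        rw [heq] at this
        apply h0; linarith
      · intro t ht
        obtain ⟨htb, htP⟩ := Finset.mem_erase.1 ht
        obtain ⟨htL, hpos, n, hn⟩ := (memP t).1 htP
        have htt := T.nL t htL
        have hnb : ⟪t, b⟫ ≠ -(2 * a) := by
          intro h
          have : t = -b := vec_eq_of (by
            simp only [inner_neg_right, inner_neg_left]; rw [h, htt, hbb]; ring)
          rw [this, inner_neg_right, hωb] at hpos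
          linarith
        rw [Finset.mem_erase, memP]
        refine ⟨?_, T.rLL t htL b hb, ?_⟩
        · intro h
          have := refl_inner t
          rw [h, hbb] at this
          apply hnb; linarith
        · rw [inner_sub_right, real_inner_smul_right, hωb, hn]
          rw [hn] at hpos
          have hn0 : 0 < n := by
            have := pos_of_mul_pos_left hpos hk.le
            exact_mod_cast this
          rcases T.pll t htL b hb with h | h | h | h | h
          · rw [h]; exact ⟨by simpa using hpos, n, by simp⟩
          · have hn1 : n ≠ 1 := by
              intro h1
              rw [h1] at hn
              rcases T.F1' htL hb (by simpa using hn) hωb htb with h' | h' <;> linarith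
            have hn2 : 0 < n - 1 := by omega
            have e : (n : ℝ) * kl - a / a * kl = ((n - 1 : ℤ) : ℝ) * kl := by
              rw [div_self ha.ne']; push_cast; ring
            rw [h, e]
            refine ⟨?_, n - 1, rfl⟩
            have : (0 : ℝ) < ((n - 1 : ℤ) : ℝ) := by exact_mod_cast hn2
            positivity
          · have e : (n : ℝ) * kl - -a / a * kl = ((n + 1 : ℤ) : ℝ) * kl := by
              rw [neg_div, div_self ha.ne']; push_cast; ring
            rw [h, e]
            refine ⟨?_, n + 1, rfl⟩
            have : (0 : ℝ) < ((n + 1 : ℤ) : ℝ) := by exact_mod_cast (by omega : 0 < n + 1)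
            positivity
          · exact absurd (vec_eq_of (by rw [h, htt, hbb]; ring)) htb
          · exact absurd h hnb
      · intro t ht
        simp only [refl_inner]
        rw [neg_div]
        module
    rw [this, add_zero]
  · intro g hg
    rw [sum_inner]
    have : ∀ t ∈ P, ∃ m : ℤ, ⟪t, g⟫ = m * a := by
      intro t ht
      have htL := ((memP t).1 ht).1
      rw [real_inner_comm]
      rcases T.psl g hg t htL with h | h | h
      · exact ⟨0, by rw [h]; simp⟩
      · exact ⟨1, by rw [h]; simp⟩
      · exact ⟨-1, by rw [h]; simp⟩
    choose! m hm using this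
    refine ⟨∑ t ∈ P, m t, ?_⟩
    rw [Finset.sum_congr rfl hm]
    push_cast
    rw [Finset.sum_mul]

/-- No short vector lies in the span of the long part of the level set. -/
theorem F3 {g : V} (hg : g ∈ Sh) :
    g ∉ Submodule.span ℝ {x | x ∈ Lo ∧ ⟪ω, x⟫ = kl} := by
  intro hgs
  have ha := T.apos
  have hk := T.klpos
  set B : Set V := {x | x ∈ Lo ∧ ⟪ω, x⟫ = kl} with hB
  obtain ⟨σ, hσ1, hσ2⟩ := T.exists_sigma
  have half : ∀ x ∈ Sh, x ∈ Submodule.span ℝ B → ∃ m : ℤ, 2 * ⟪ω, x⟫ = m * kl := by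
    intro x hx hxB
    obtain ⟨m, hm⟩ := hσ2 x hx
    refine ⟨m, ?_⟩
    have h0 : ⟪kl • σ - (2 * a) • ω, x⟫ = 0 := by
      refine orth_span (fun x h => ?_) hxB
      rw [inner_sub_left, real_inner_smul_left, real_inner_smul_left, hσ1 x h.1 h.2, h.2]; ring
    rw [inner_sub_left, real_inner_smul_left, real_inner_smul_left, hm] at h0
    have : a * (2 * ⟪ω, x⟫) = a * (m * kl) := by linarith
    exact mul_left_cancel₀ ha.ne' this
  obtain ⟨x, ⟨hxS, hxB⟩, hmin⟩ := Set.exists_min_image {x | x ∈ Sh ∧ x ∈ Submodule.span ℝ B}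
    (fun x => |⟪ω, x⟫|) (T.finS.subset (fun x hx => hx.1)) ⟨g, hg, hgs⟩
  have main : ∀ x ∈ Sh, x ∈ Submodule.span ℝ B →
      (∀ y, y ∈ Sh → y ∈ Submodule.span ℝ B → |⟪ω, x⟫| ≤ |⟪ω, y⟫|) → 0 < ⟪ω, x⟫ → False := by
    intro x hxS hxB hmin hpos
    obtain ⟨b, hb, hxb⟩ : ∃ b ∈ B, 0 < ⟪x, b⟫ := by
      by_contra hcon
      push Not at hcon
      have := obtuse_span (ω := ω) (B := B) (fun u hu v hv huv => by
        rcases T.F1' hu.1 hv.1 hu.2 hv.2 huv with h | h <;> linarith)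
        (fun u hu => by rw [hu.2]; exact hk) hxB hcon
      linarith
    have hxb' : ⟪x, b⟫ = a := by
      rcases T.psl x hxS b hb.1 with h | h | h
      · linarith
      · exact h
      · linarith
    have h1 := T.rSL x hxS b hb.1
    rw [hxb', div_self ha.ne', one_smul] at h1
    have h2 := hmin _ h1 (Submodule.sub_mem _ hxB (Submodule.subset_span hb))
    have h3 := T.regS _ h1
    have h4 := T.regL _ (T.delta_mem hxS hb.1 hxb')
    rw [inner_sub_right, hb.2] at h2 h3
    rw [inner_sub_right, real_inner_smul_right, hb.2] at h4
    obtain ⟨m, hm⟩ := half x hxS hxB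
    have hle : 2 * ⟪ω, x⟫ ≤ kl := by
      rw [abs_of_pos hpos] at h2
      rcases le_abs.1 h2 with h | h <;> linarith
    have m0 : 0 < m := by
      have : 0 < (m : ℝ) * kl := by linarith
      have := pos_of_mul_pos_left this hk.le
      exact_mod_cast this
    have m1 : (1 : ℝ) ≤ m := by exact_mod_cast m0
    apply h4
    nlinarith
  rcases lt_or_gt_of_ne (T.regS x hxS) with h | h
  · refine main (-x) (T.negS hxS) (Submodule.neg_mem _ hxB) (fun y h1 h2 => ?_) ?_
    · rw [inner_neg_right, abs_neg]; exact hmin y ⟨h1, h2⟩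
    · rw [inner_neg_right]; linarith
  · exact main x hxS hxB (fun y h1 h2 => hmin y ⟨h1, h2⟩) h

end basic3

/-- If `K` is orthogonal to `R` and `x ∈ K'`-span-side splits, the `R` part drops out. -/
theorem span_drop {K R : Set V} {x : V} (hKR : ∀ k ∈ K, ∀ r ∈ R, ⟪k, r⟫ = 0)
    (hxR : ∀ r ∈ R, ⟪x, r⟫ = 0) (hx : x ∈ Submodule.span ℝ (K ∪ R)) :
    x ∈ Submodule.span ℝ K := by
  rw [Submodule.span_union, Submodule.mem_sup] at hx
  obtain ⟨y, hy, w, hw, rfl⟩ := hx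
  have h1 : ⟪y + w, w⟫ = 0 := orth_span hxR hw
  have h2 : ⟪w, y⟫ = 0 := orth_span (fun k hk => by
    rw [real_inner_comm]; exact orth_span (hKR k hk) hw) hy
  rw [inner_add_left, real_inner_comm, h2, zero_add] at h1
  rw [inner_self_eq_zero.1 h1, add_zero]
  exact hy

section basic4
variable (T : TwoLen Sh Lo a ω ks kl)
include T

theorem caseB {x : V} (hx : x ∈ Sh) (hωx : ⟪ω, x⟫ = ks)
    (hno : ∀ y ∈ Sh, ⟪ω, y⟫ = ks → x ≠ y → ⟪x, y⟫ = 0) :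
    x ∉ Submodule.span ℝ
      (({z | z ∈ Sh ∧ ⟪ω, z⟫ = ks} ∪ {z | z ∈ Lo ∧ ⟪ω, z⟫ = kl}) \ {x}) := by
  intro hmem
  have ha := T.apos
  set K : Set V := {b | (b ∈ Lo ∧ ⟪ω, b⟫ = kl) ∧ ∀ y ∈ Sh, ⟪ω, y⟫ = ks → x ≠ y →
    ∀ c ∈ Lo, ⟪y, c⟫ ≠ 0 → ⟪b, c⟫ = 0} with hK
  set R : Set V := {z | (z ∈ Sh ∧ ⟪ω, z⟫ = ks) ∧ x ≠ z} ∪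
    {b | (b ∈ Lo ∧ ⟪ω, b⟫ = kl) ∧ b ∉ K} with hR
  have hsub : (({z | z ∈ Sh ∧ ⟪ω, z⟫ = ks} ∪ {z | z ∈ Lo ∧ ⟪ω, z⟫ = kl}) \ {x}) ⊆ K ∪ R := by
    rintro z ⟨hz | hz, hzx⟩
    · exact Or.inr (Or.inl ⟨hz, fun h => hzx h.symm⟩)
    · by_cases hzK : z ∈ K
      · exact Or.inl hzK
      · exact Or.inr (Or.inr ⟨hz, hzK⟩)
  have h1 := span_drop (K := K) (R := R) (x := x) ?_ ?_ (Submodule.span_mono hsub hmem)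
  · exact T.F3 hx (Submodule.span_mono (fun z hz => hz.1) h1)
  · rintro b ⟨hb, hbK⟩ r (⟨hr, hrx⟩ | ⟨hr, hrK⟩)
    · rw [real_inner_comm]
      by_contra hc
      have := hbK r hr.1 hr.2 hrx b hb.1 hc
      rw [T.nL b hb.1] at this
      linarith
    · by_contra hc
      exact hrK ⟨hr, fun y hy hωy hxy => T.F5 (hbK y hy hωy hxy) hr.1 hc⟩
  · rintro r (⟨hr, hrx⟩ | ⟨hr, hrK⟩)
    · exact hno r hr.1 hr.2 hrx
    · by_contra hc
      exact hrK ⟨hr, fun y hy hωy hxy c hc' hyc =>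
        T.F4 hx hy hωx hωy (hno y hy hωy hxy) hr.1 hc hc' hyc⟩

theorem caseC {x : V} (hx : x ∈ Lo) (hωx : ⟪ω, x⟫ = kl)
    (hno : ∀ y ∈ Lo, ⟪ω, y⟫ = kl → x ≠ y → ⟪x, y⟫ = 0) :
    x ∉ Submodule.span ℝ
      (({z | z ∈ Sh ∧ ⟪ω, z⟫ = ks} ∪ {z | z ∈ Lo ∧ ⟪ω, z⟫ = kl}) \ {x}) := by
  intro hmem
  have ha := T.apos
  refine T.dual.caseB hx hωx hno (Submodule.span_le.2 ?_ hmem)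
  rintro z ⟨hz | hz, hzx⟩
  · have : z = (1 / 2 : ℝ) • ((2 : ℝ) • z) := by module
    rw [this]
    refine Submodule.smul_mem _ _ (Submodule.subset_span ⟨Or.inr ⟨⟨z, hz.1, rfl⟩, ?_⟩, ?_⟩)
    · rw [real_inner_smul_right, hz.2]
    · intro h
      have h' : (2 : ℝ) • z = x := h
      have h2 := T.nL x hx
      rw [← h', real_inner_smul_left, real_inner_smul_right, T.nS z hz.1] at h2
      linarith
  · exact Submodule.subset_span ⟨Or.inl hz, hzx⟩

theorem caseA {x y b b' : V} (hx : x ∈ Sh) (hy : y ∈ Sh)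
    (hωx : ⟪ω, x⟫ = ks) (hωy : ⟪ω, y⟫ = ks) (hxy : x ≠ y)
    (hb : b ∈ Lo) (hb' : b' ∈ Lo) (hωb : ⟪ω, b⟫ = kl) (hωb' : ⟪ω, b'⟫ = kl) (hbb' : b ≠ b')
    (hxb : ⟪x, b⟫ = a) (ixy : ⟪x, y⟫ ≠ 0) (ibb' : ⟪b, b'⟫ ≠ 0) :
    x ∉ Submodule.span ℝ
      (({z | z ∈ Sh ∧ ⟪ω, z⟫ = ks} ∪ {z | z ∈ Lo ∧ ⟪ω, z⟫ = kl}) \ {x}) := by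
  intro hmem
  have ha := T.apos
  set R : Set V := (({z | z ∈ Sh ∧ ⟪ω, z⟫ = ks} ∪ {z | z ∈ Lo ∧ ⟪ω, z⟫ = kl}) \ {x, y, b, b'})
    with hR
  have hRo : ∀ z ∈ R, ⟪z, x⟫ = 0 ∧ ⟪z, y⟫ = 0 ∧ ⟪z, b⟫ = 0 ∧ ⟪z, b'⟫ = 0 := by
    rintro z ⟨hz | hz, hzn⟩
    · simp only [Set.mem_insert_iff, Set.mem_singleton_iff, not_or] at hzn
      exact T.F9 hx hy hz.1 hωx hωy hz.2 hxy (Ne.symm hzn.1) (Ne.symm hzn.2.1) hb hb' hωb hωb'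
        hbb' hxb ixy ibb'
    · simp only [Set.mem_insert_iff, Set.mem_singleton_iff, not_or] at hzn
      exact T.F9' hx hy hz.1 hωx hωy hz.2 hxy (Ne.symm hzn.2.2.1) (Ne.symm hzn.2.2.2) hb hb' hωb
        hωb' hbb' hxb ixy ibb'
  have hsub : (({z | z ∈ Sh ∧ ⟪ω, z⟫ = ks} ∪ {z | z ∈ Lo ∧ ⟪ω, z⟫ = kl}) \ {x}) ⊆
      {y, b, b'} ∪ R := by
    rintro z ⟨hz, hzx⟩
    by_cases h : z ∈ ({y, b, b'} : Set V)
    · exact Or.inl h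
    · refine Or.inr ⟨hz, ?_⟩
      rw [Set.mem_insert_iff, not_or]
      exact ⟨hzx, h⟩
  have h1 := span_drop (x := x) (K := {y, b, b'}) (R := R) (by
      rintro k (rfl | rfl | rfl) r hr <;> rw [real_inner_comm]
      · exact (hRo r hr).2.1
      · exact (hRo r hr).2.2.1
      · exact (hRo r hr).2.2.2) (fun r hr => by rw [real_inner_comm]; exact (hRo r hr).1)
      (Submodule.span_mono hsub hmem)
  obtain ⟨g, c, c', he⟩ := Submodule.mem_span_triple.1 h1
  obtain ⟨jxy, jyb⟩ := (T.F6 hx hy hωx hωy hxy hb hxb).resolve_left (fun h => ixy h.1)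
  obtain ⟨jbb', jxb'⟩ := (T.F6' hb hb' hωb hωb' hbb' hx hxb).resolve_left (fun h => ibb' h.1)
  have hxx := T.nS x hx
  have hyy := T.nS y hy
  have hbb := T.nL b hb
  have hb'b' := T.nL b' hb'
  have e1 : g * ⟪x, y⟫ + c * ⟪x, b⟫ + c' * ⟪x, b'⟫ = ⟪x, x⟫ := by
    conv_rhs => rw [← he]
    rw [inner_add_left, inner_add_left, real_inner_smul_left, real_inner_smul_left,
      real_inner_smul_left, he, real_inner_comm x y, real_inner_comm x b, real_inner_comm x b']
  have e2 : g * ⟪y, y⟫ + c * ⟪y, b⟫ + c' * ⟪y, b'⟫ = ⟪x, y⟫ := by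
    conv_rhs => rw [← he]
    simp only [inner_add_left, real_inner_smul_left]
    conv_rhs => rw [real_inner_comm y b, real_inner_comm y b']
  have e3 : g * ⟪y, b⟫ + c * ⟪b, b⟫ + c' * ⟪b, b'⟫ = ⟪x, b⟫ := by
    conv_rhs => rw [← he]
    simp only [inner_add_left, real_inner_smul_left]
    conv_rhs => rw [real_inner_comm b b']
  have e4 : g * ⟪y, b'⟫ + c * ⟪b, b'⟫ + c' * ⟪b', b'⟫ = ⟪x, b'⟫ := by
    conv_rhs => rw [← he]
    simp only [inner_add_left, real_inner_smul_left]
  rw [jxy, hxb, hxx] at e1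
  rw [jxy, hyy] at e2
  rw [jbb', hbb, hxb] at e3
  rw [jbb', hb'b'] at e4
  rcases jyb with p | p <;> rcases jxb' with q | q <;>
    rcases T.psl y hy b' hb' with r | r | r <;>
    rw [p] at e2 e3 <;> rw [q] at e1 e4 <;> rw [r] at e2 e4 <;> clear p q r <;>
    linarith

theorem main {x b : V} (hx : x ∈ Sh) (hωx : ⟪ω, x⟫ = ks) (hb : b ∈ Lo) (hωb : ⟪ω, b⟫ = kl)
    (hxb : ⟪x, b⟫ = a) :
    x ∉ Submodule.span ℝ
      (({z | z ∈ Sh ∧ ⟪ω, z⟫ = ks} ∪ {z | z ∈ Lo ∧ ⟪ω, z⟫ = kl}) \ {x}) ∨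
    b ∉ Submodule.span ℝ
      (({z | z ∈ Sh ∧ ⟪ω, z⟫ = ks} ∪ {z | z ∈ Lo ∧ ⟪ω, z⟫ = kl}) \ {b}) := by
  by_cases h1 : ∀ y ∈ Sh, ⟪ω, y⟫ = ks → x ≠ y → ⟪x, y⟫ = 0
  · exact Or.inl (T.caseB hx hωx h1)
  by_cases h2 : ∀ y ∈ Lo, ⟪ω, y⟫ = kl → b ≠ y → ⟪b, y⟫ = 0
  · exact Or.inr (T.caseC hb hωb h2)
  push Not at h1 h2
  obtain ⟨y, hy, hωy, hxy, ixy⟩ := h1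
  obtain ⟨b', hb', hωb', hbb', ibb'⟩ := h2
  exact Or.inl (T.caseA hx hy hωx hωy hxy hb hb' hωb hωb' hbb' hxb ixy ibb')

end basic4

end TwoLen

end TwoLength

section RootPart

variable {V : Type*} [NormedAddCommGroup V] [InnerProductSpace ℝ V] {Φ : Finset V}

namespace IsRootSystem

theorem ipos (hΦ : IsRootSystem Φ) {x : V} (hx : x ∈ Φ) : 0 < ⟪x, x⟫ :=
  real_inner_self_pos.2 (fun h => hΦ.zero_not_mem (h ▸ hx))

theorem sRefl_self {x : V} (hx : 0 < ⟪x, x⟫) : sRefl x x = -x := by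
  unfold sRefl
  rw [mul_div_assoc, div_self hx.ne']; module

theorem neg_mem' (hΦ : IsRootSystem Φ) {x : V} (hx : x ∈ Φ) : -x ∈ Φ := by
  rw [← sRefl_self (hΦ.ipos hx)]; exact hΦ.refl_mem x hx x hx

theorem sRefl_inner {y : V} (hy : 0 < ⟪y, y⟫) (x z : V) : ⟪sRefl y x, sRefl y z⟫ = ⟪x, z⟫ := by
  unfold sRefl
  simp only [inner_sub_left, inner_sub_right, real_inner_smul_left, real_inner_smul_right,
    real_inner_comm z y]
  field_simp
  ring

theorem ints (hΦ : IsRootSystem Φ) {x y : V} (hx : x ∈ Φ) (hy : y ∈ Φ) :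
    ∃ n : ℤ, 2 * ⟪x, y⟫ = n * ⟪y, y⟫ := by
  obtain ⟨n, hn⟩ := hΦ.crystallographic y hy x hx
  exact ⟨n, by rw [← hn, div_mul_cancel₀ _ (hΦ.ipos hy).ne']⟩

theorem cs (x y : V) : ⟪x, y⟫ * ⟪x, y⟫ ≤ ⟪x, x⟫ * ⟪y, y⟫ := real_inner_mul_inner_self_le x y

theorem v1 (hΦ : IsRootSystem Φ) {x y : V} (hx : x ∈ Φ) (hy : y ∈ Φ) (h : ⟪y, y⟫ = ⟪x, x⟫) :
    ⟪x, y⟫ = 0 ∨ ⟪x, y⟫ = ⟪x, x⟫ / 2 ∨ ⟪x, y⟫ = -(⟪x, x⟫ / 2) ∨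
    ⟪x, y⟫ = ⟪x, x⟫ ∨ ⟪x, y⟫ = -⟪x, x⟫ := by
  have hp := hΦ.ipos hx
  obtain ⟨n, hn⟩ := hΦ.ints hx hy
  have hc := cs x y
  rw [h] at hn hc
  generalize ⟪x, x⟫ = X at *
  have hv : ⟪x, y⟫ = n / 2 * X := by linarith
  rw [hv] at hc ⊢
  have h4 : ((n : ℝ)) ^ 2 ≤ 4 := by
    have : (n : ℝ) ^ 2 * (X * X) ≤ 4 * (X * X) := by nlinarith
    exact le_of_mul_le_mul_right this (by positivity)
  have h4' : n ^ 2 ≤ 4 := by exact_mod_cast h4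
  have hl : -2 ≤ n := by nlinarith
  have hu : n ≤ 2 := by nlinarith
  clear hn hv hc h4 h4' h
  interval_cases n
  · right; right; right; right; push_cast; ring
  · right; right; left; push_cast; ring
  · left; push_cast; ring
  · right; left; push_cast; ring
  · right; right; right; left; push_cast; ring

theorem v23 (hΦ : IsRootSystem Φ) {x y : V} (hx : x ∈ Φ) (hy : y ∈ Φ) {k : ℝ} (hk : 2 ≤ k)
    (h : ⟪y, y⟫ = k * ⟪x, x⟫) :
    ⟪x, y⟫ = 0 ∨ ⟪x, y⟫ = k * ⟪x, x⟫ / 2 ∨ ⟪x, y⟫ = -(k * ⟪x, x⟫ / 2) := by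
  have hp := hΦ.ipos hx
  obtain ⟨n, hn⟩ := hΦ.ints hx hy
  have hc := cs x y
  rw [h] at hn hc
  generalize ⟪x, x⟫ = X at *
  have hv : ⟪x, y⟫ = n / 2 * (k * X) := by linarith
  rw [hv] at hc ⊢
  have h4 : ((n : ℝ)) ^ 2 * k ≤ 4 := by
    have : ((n : ℝ) ^ 2 * k) * (X * X * k) ≤ 4 * (X * X * k) := by nlinarith
    exact le_of_mul_le_mul_right this (by positivity)
  have h4 : ((n : ℝ)) ^ 2 ≤ 2 := by nlinarith [sq_nonneg (n : ℝ)]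
  have h4' : n ^ 2 ≤ 2 := by exact_mod_cast h4
  have hl : -1 ≤ n := by nlinarith
  have hu : n ≤ 1 := by nlinarith
  clear hn hv hc h4 h4' h
  interval_cases n
  · right; right; push_cast; ring
  · left; push_cast; ring
  · right; left; push_cast; ring

theorem ratio (hΦ : IsRootSystem Φ) {x y : V} (hx : x ∈ Φ) (hy : y ∈ Φ) (h : ⟪x, y⟫ ≠ 0) :
    ⟪y, y⟫ = ⟪x, x⟫ ∨ ⟪y, y⟫ = 2 * ⟪x, x⟫ ∨ ⟪y, y⟫ = 3 * ⟪x, x⟫ ∨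
    ⟪x, x⟫ = 2 * ⟪y, y⟫ ∨ ⟪x, x⟫ = 3 * ⟪y, y⟫ := by
  have hpx := hΦ.ipos hx
  have hpy := hΦ.ipos hy
  obtain ⟨n, hn⟩ := hΦ.ints hx hy
  obtain ⟨m, hm⟩ := hΦ.ints hy hx
  rw [real_inner_comm] at hm
  have hc := cs x y
  have hnm : (n : ℝ) * m ≤ 4 := by
    have : ((n : ℝ) * m) * (⟪x, x⟫ * ⟪y, y⟫) ≤ 4 * (⟪x, x⟫ * ⟪y, y⟫) := by
      have : ((n : ℝ) * m) * (⟪x, x⟫ * ⟪y, y⟫) = (2 * ⟪x, y⟫) * (2 * ⟪x, y⟫) := by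
        nth_rewrite 1 [hn]; rw [hm]; ring
      rw [this]; linarith
    exact le_of_mul_le_mul_right this (by positivity)
  have hnm0 : 0 < (n : ℝ) * m := by
    have : 0 < ((n : ℝ) * m) * (⟪x, x⟫ * ⟪y, y⟫) := by
      have : ((n : ℝ) * m) * (⟪x, x⟫ * ⟪y, y⟫) = (2 * ⟪x, y⟫) * (2 * ⟪x, y⟫) := by
        nth_rewrite 1 [hn]; rw [hm]; ring
      rw [this]; exact mul_self_pos.2 (mul_ne_zero two_ne_zero h)
    exact pos_of_mul_pos_left this (by positivity)
  have i1 : n * m ≤ 4 := by exact_mod_cast hnm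
  have i0 : 0 < n * m := by exact_mod_cast hnm0
  by_cases i4 : n * m = 4
  · left
    have r4 : (n : ℝ) * m = 4 := by exact_mod_cast i4
    have e : x = ((n : ℝ) / 2) • y := TwoLen.vec_eq_of (by
      simp only [real_inner_smul_left, real_inner_smul_right]
      have h1 : (n : ℝ) * ⟪y, y⟫ = m * ⟪x, x⟫ := by linarith
      have h2 : (n : ℝ) * (n * ⟪y, y⟫) = 4 * ⟪x, x⟫ := by rw [h1, ← r4]; ring
      have h3 : (n : ℝ) * (2 * ⟪x, y⟫) = 4 * ⟪x, x⟫ := by rw [hm, ← r4]; ring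
      linarith)
    have := hΦ.reduced y hy ((n : ℝ) / 2) (e ▸ hx)
    rcases this with h | h <;> rw [h] at e <;> rw [e] <;> simp
  · have hn0 : n ≠ 0 := by rintro rfl; simp at i0
    have hm0 : m ≠ 0 := by rintro rfl; simp at i0
    have i3 : n * m ≤ 3 := by omega
    have hn3 : |n| ≤ 3 := by
      have h1 : 1 ≤ |m| := Int.one_le_abs hm0
      have : |n| * |m| ≤ 3 := by rw [← abs_mul, abs_of_pos i0]; exact i3
      nlinarith [abs_nonneg n]
    have hm3 : |m| ≤ 3 := by
      have h1 : 1 ≤ |n| := Int.one_le_abs hn0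
      have : |n| * |m| ≤ 3 := by rw [← abs_mul, abs_of_pos i0]; exact i3
      nlinarith [abs_nonneg m]
    rw [abs_le] at hn3 hm3
    obtain ⟨n1, n2⟩ := hn3
    obtain ⟨m1, m2⟩ := hm3
    clear hnm hnm0 i1 i4 hc
    have h1 : (n : ℝ) * ⟪y, y⟫ = m * ⟪x, x⟫ := by linarith
    clear hn hm
    generalize ⟪x, x⟫ = X at *
    generalize ⟪y, y⟫ = Y at *
    interval_cases n <;> interval_cases m <;> first
      | (exfalso; omega)
      | (left; push_cast at h1; linarith)
      | (right; left; push_cast at h1; linarith)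
      | (right; right; left; push_cast at h1; linarith)
      | (right; right; right; left; push_cast at h1; linarith)
      | (right; right; right; right; push_cast at h1; linarith)

theorem refl_half (hΦ : IsRootSystem Φ) {x y : V} (hx : x ∈ Φ) (h : ⟪y, y⟫ = ⟪x, x⟫)
    (hxy : ⟪x, y⟫ = ⟪x, x⟫ / 2) : sRefl y x = x - y := by
  have := hΦ.ipos hx
  unfold sRefl
  have e : 2 * (⟪x, x⟫ / 2) / ⟪x, x⟫ = 1 := by field_simp
  rw [hxy, h, e, one_smul]

section withs
variable (hΦ : IsRootSystem Φ) {ω : V} (hω : ∀ α ∈ Φ, ⟪ω, α⟫ ≠ 0)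
    {s : V → ℝ} (hpos : ∀ α ∈ Φ, 0 < s α)
    (hinv : ∀ α ∈ Φ, ∀ β ∈ Φ, s (sRefl β α) = s α)

include hΦ hinv

theorem s_neg {x : V} (hx : x ∈ Φ) : s (-x) = s x := by
  rw [← sRefl_self (hΦ.ipos hx)]; exact hinv x hx x hx

theorem s_conj {x y : V} (hx : x ∈ Φ) (hy : y ∈ Φ) (h : ⟪y, y⟫ = ⟪x, x⟫) (hxy : ⟪x, y⟫ ≠ 0) :
    s x = s y := by
  have key : ∀ x y : V, x ∈ Φ → y ∈ Φ → ⟪y, y⟫ = ⟪x, x⟫ → ⟪x, y⟫ = ⟪x, x⟫ / 2 → s x = s y := by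
    intro x y hx hy h hxy
    have e1 := refl_half hΦ hx h hxy
    have e2 := refl_half hΦ hy h.symm (by rw [real_inner_comm, hxy, h])
    have h1 := hinv x hx y hy
    have h2 := hinv y hy x hx
    have h3 := hΦ.refl_mem y hy x hx
    rw [e1] at h1 h3
    rw [e2] at h2
    have h4 := hΦ.s_neg hinv h3
    rw [neg_sub] at h4
    rw [← h1, ← h2, h4]
  rcases hΦ.v1 hx hy h with g | g | g | g | g
  · exact absurd g hxy
  · exact key x y hx hy h g
  · rw [← hΦ.s_neg hinv hy]
    exact key x (-y) hx (hΦ.neg_mem' hy) (by rw [inner_neg_neg, h])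
      (by rw [inner_neg_right, g]; ring)
  · rw [TwoLen.vec_eq_of (x := x) (y := y) (by rw [g, h]; ring)]
  · rw [TwoLen.vec_eq_of (x := x) (y := -y) (by rw [inner_neg_neg, inner_neg_right, g, h]; ring),
      hΦ.s_neg hinv hy]

include hω hpos in
theorem obt {x y : V} (hx : x ∈ Φ) (hy : y ∈ Φ) (h : ⟪y, y⟫ = ⟪x, x⟫) (hne : x ≠ y)
    (hωx : ⟪ω, x⟫ = s x) (hωy : ⟪ω, y⟫ = s y) : ⟪x, y⟫ = 0 ∨ ⟪x, y⟫ = -(⟪x, x⟫ / 2) := by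
  have hp := hΦ.ipos hx
  rcases hΦ.v1 hx hy h with g | g | g | g | g
  · exact Or.inl g
  · exfalso
    have h1 := hΦ.refl_mem y hy x hx
    rw [refl_half hΦ hx h g] at h1
    apply hω _ h1
    rw [inner_sub_right, hωx, hωy, hΦ.s_conj hinv hx hy h (by rw [g]; positivity), sub_self]
  · exact Or.inr g
  · exact absurd (TwoLen.vec_eq_of (by rw [g, h]; ring)) hne
  · exfalso
    have e := TwoLen.vec_eq_of (x := x) (y := -y) (by
      rw [inner_neg_neg, inner_neg_right, g, h]; ring)
    have h1 := hpos x hx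
    have h2 := hpos y hy
    rw [← hωx, e, inner_neg_right, hωy] at h1
    linarith

end withs

end IsRootSystem

end RootPart

section RootPart2

variable {V : Type*} [NormedAddCommGroup V] [InnerProductSpace ℝ V] {Φ : Finset V}

namespace IsRootSystem

/-- `θ` is not orthogonal to some root of square norm `n` and weight `p`. -/
def Wit (Φ : Finset V) (s : V → ℝ) (n p : ℝ) (θ : V) : Prop :=
  ∃ x ∈ Φ, ⟪x, x⟫ = n ∧ s x = p ∧ ⟪x, θ⟫ ≠ 0

theorem wit_step (hΦ : IsRootSystem Φ) {s : V → ℝ}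
    (hinv : ∀ α ∈ Φ, ∀ β ∈ Φ, s (sRefl β α) = s α) {n p : ℝ} {θ θ' : V} (hθ : θ ∈ Φ)
    (h : Wit Φ s n p θ) (hne : ⟪θ, θ'⟫ ≠ 0) : Wit Φ s n p θ' := by
  obtain ⟨x, hx, hxn, hsx, hxθ⟩ := h
  by_cases h0 : ⟪x, θ'⟫ = 0
  · refine ⟨sRefl θ x, hΦ.refl_mem θ hθ x hx, by rw [sRefl_inner (hΦ.ipos hθ), hxn],
      by rw [hinv x hx θ hθ, hsx], ?_⟩
    unfold sRefl
    rw [inner_sub_left, h0, real_inner_smul_left, zero_sub, neg_ne_zero]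
    exact mul_ne_zero (div_ne_zero (mul_ne_zero two_ne_zero hxθ) (hΦ.ipos hθ).ne') hne
  · exact ⟨x, hx, hxn, hsx, h0⟩

theorem wit_refl (hΦ : IsRootSystem Φ) {s : V → ℝ}
    (hinv : ∀ α ∈ Φ, ∀ β ∈ Φ, s (sRefl β α) = s α) {n p : ℝ} {θ y : V} (hy : y ∈ Φ)
    (h : Wit Φ s n p θ) : Wit Φ s n p (sRefl y θ) := by
  obtain ⟨x, hx, hxn, hsx, hxθ⟩ := h
  exact ⟨sRefl y x, hΦ.refl_mem y hy x hx, by rw [sRefl_inner (hΦ.ipos hy), hxn],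
      by rw [hinv x hx y hy, hsx], by rwa [sRefl_inner (hΦ.ipos hy)]⟩

theorem wit_s (hΦ : IsRootSystem Φ) {s : V → ℝ}
    (hinv : ∀ α ∈ Φ, ∀ β ∈ Φ, s (sRefl β α) = s α) {n p : ℝ} {θ : V} (hθ : θ ∈ Φ)
    (h : Wit Φ s n p θ) (hn : ⟪θ, θ⟫ = n) : s θ = p := by
  obtain ⟨x, hx, hxn, hsx, hxθ⟩ := h
  rw [← hsx]
  exact (hΦ.s_conj hinv hx hθ (by rw [hn, hxn]) hxθ).symm

theorem wit_norm (hΦ : IsRootSystem Φ) {s : V → ℝ} {a p q k : ℝ} (ha : 0 < a)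
    (hk : k = 2 ∨ k = 3) {θ : V} (hθ : θ ∈ Φ)
    (h : Wit Φ s a p θ) (h' : Wit Φ s (k * a) q θ) : ⟪θ, θ⟫ = a ∨ ⟪θ, θ⟫ = k * a := by
  obtain ⟨x, hx, hxn, hsx, hxθ⟩ := h
  obtain ⟨y, hy, hyn, hsy, hyθ⟩ := h'
  have h1 := hΦ.ratio hx hθ hxθ
  have h2 := hΦ.ratio hy hθ hyθ
  rw [hxn] at h1
  rw [hyn] at h2
  generalize ⟪θ, θ⟫ = t at *
  rcases hk with rfl | rfl <;> rcases h1 with h1 | h1 | h1 | h1 | h1 <;>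
    rcases h2 with h2 | h2 | h2 | h2 | h2 <;>
    first
    | (left; linarith)
    | (right; linarith)
    | (exfalso; linarith)

/-- The two-length component. -/
def RR (Φ : Finset V) (s : V → ℝ) (k a p q : ℝ) (θ : V) : Prop :=
  θ ∈ Φ ∧ Wit Φ s a p θ ∧ Wit Φ s (k * a) q θ

theorem rr_step (hΦ : IsRootSystem Φ) {s : V → ℝ}
    (hinv : ∀ α ∈ Φ, ∀ β ∈ Φ, s (sRefl β α) = s α) {k a p q : ℝ} {θ θ' : V}
    (h : RR Φ s k a p q θ) (hθ' : θ' ∈ Φ) (hne : ⟪θ, θ'⟫ ≠ 0) : RR Φ s k a p q θ' :=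
  ⟨hθ', hΦ.wit_step hinv h.1 h.2.1 hne, hΦ.wit_step hinv h.1 h.2.2 hne⟩

theorem rr_refl (hΦ : IsRootSystem Φ) {s : V → ℝ}
    (hinv : ∀ α ∈ Φ, ∀ β ∈ Φ, s (sRefl β α) = s α) {k a p q : ℝ} {θ y : V}
    (h : RR Φ s k a p q θ) (hy : y ∈ Φ) : RR Φ s k a p q (sRefl y θ) :=
  ⟨hΦ.refl_mem y hy θ h.1, hΦ.wit_refl hinv hy h.2.1, hΦ.wit_refl hinv hy h.2.2⟩

theorem two_len (hΦ : IsRootSystem Φ) {ω : V} (hω : ∀ α ∈ Φ, ⟪ω, α⟫ ≠ 0) {s : V → ℝ}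
    (hinv : ∀ α ∈ Φ, ∀ β ∈ Φ, s (sRefl β α) = s α) {a p q : ℝ} (ha : 0 < a)
    (hp : 0 < p) (hq : 0 < q) :
    TwoLen {z | RR Φ s 2 a p q z ∧ ⟪z, z⟫ = a} {z | RR Φ s 2 a p q z ∧ ⟪z, z⟫ = 2 * a}
      a ω p q where
  finS := Φ.finite_toSet.subset fun z hz => hz.1.1
  finL := Φ.finite_toSet.subset fun z hz => hz.1.1
  apos := ha
  kspos := hp
  klpos := hq
  nS := fun x hx => hx.2
  nL := fun x hx => hx.2
  pss := by
    rintro x ⟨hx, hxn⟩ y ⟨hy, hyn⟩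
    have := hΦ.v1 hx.1 hy.1 (by rw [hxn, hyn])
    rwa [hxn] at this
  pll := by
    rintro x ⟨hx, hxn⟩ y ⟨hy, hyn⟩
    have := hΦ.v1 hx.1 hy.1 (by rw [hxn, hyn])
    rwa [hxn, mul_div_cancel_left₀ a two_ne_zero] at this
  psl := by
    rintro x ⟨hx, hxn⟩ y ⟨hy, hyn⟩
    have := hΦ.v23 hx.1 hy.1 (le_refl 2) (by rw [hxn, hyn])
    rwa [hxn, mul_div_cancel_left₀ a two_ne_zero] at this
  rSS := by
    rintro x ⟨hx, hxn⟩ y ⟨hy, hyn⟩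
    have h1 := hΦ.rr_refl hinv hx hy.1
    have h2 := sRefl_inner (hΦ.ipos hy.1) x x
    have e : sRefl y x = x - (2 * ⟪x, y⟫ / a) • y := by unfold sRefl; rw [hyn]
    rw [e] at h1 h2
    exact ⟨h1, h2.trans hxn⟩
  rSL := by
    rintro x ⟨hx, hxn⟩ y ⟨hy, hyn⟩
    have h1 := hΦ.rr_refl hinv hx hy.1
    have h2 := sRefl_inner (hΦ.ipos hy.1) x x
    have e : sRefl y x = x - (⟪x, y⟫ / a) • y := by
      unfold sRefl; rw [hyn, mul_div_mul_left _ _ two_ne_zero]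
    rw [e] at h1 h2
    exact ⟨h1, h2.trans hxn⟩
  rLS := by
    rintro x ⟨hx, hxn⟩ y ⟨hy, hyn⟩
    have h1 := hΦ.rr_refl hinv hx hy.1
    have h2 := sRefl_inner (hΦ.ipos hy.1) x x
    have e : sRefl y x = x - (2 * ⟪y, x⟫ / a) • y := by
      unfold sRefl; rw [hyn, real_inner_comm]
    rw [e] at h1 h2
    exact ⟨h1, h2.trans hxn⟩
  rLL := by
    rintro x ⟨hx, hxn⟩ y ⟨hy, hyn⟩
    have h1 := hΦ.rr_refl hinv hx hy.1
    have h2 := sRefl_inner (hΦ.ipos hy.1) x x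
    have e : sRefl y x = x - (⟪x, y⟫ / a) • y := by
      unfold sRefl; rw [hyn, mul_div_mul_left _ _ two_ne_zero]
    rw [e] at h1 h2
    exact ⟨h1, h2.trans hxn⟩
  regS := fun x hx => hω x hx.1.1
  regL := fun x hx => hω x hx.1.1

theorem ratio_two (hΦ : IsRootSystem Φ) {ω : V} (hω : ∀ α ∈ Φ, ⟪ω, α⟫ ≠ 0) {s : V → ℝ}
    (hpos : ∀ α ∈ Φ, 0 < s α)
    (hinv : ∀ α ∈ Φ, ∀ β ∈ Φ, s (sRefl β α) = s α) {α β : V} (hα : α ∈ Φ) (hβ : β ∈ Φ)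
    (hωα : ⟪ω, α⟫ = s α) (hωβ : ⟪ω, β⟫ = s β) (hn : ⟪β, β⟫ = 2 * ⟪α, α⟫)
    (hαβ : ⟪α, β⟫ = ⟪α, α⟫) :
    α ∉ Submodule.span ℝ ({z | z ∈ Φ ∧ ⟪ω, z⟫ = s z} \ {α}) ∨
    β ∉ Submodule.span ℝ ({z | z ∈ Φ ∧ ⟪ω, z⟫ = s z} \ {β}) := by
  have ha := hΦ.ipos hα
  have hne : ⟪α, β⟫ ≠ 0 := by rw [hαβ]; exact ha.ne'
  have hb := hΦ.ipos hβ
  have T := hΦ.two_len hω hinv ha (hpos α hα) (hpos β hβ)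
  have Rα : RR Φ s 2 ⟪α, α⟫ (s α) (s β) α :=
    ⟨hα, ⟨α, hα, rfl, rfl, ha.ne'⟩, ⟨β, hβ, hn, rfl, by rwa [real_inner_comm]⟩⟩
  have Rβ : RR Φ s 2 ⟪α, α⟫ (s α) (s β) β :=
    ⟨hβ, ⟨α, hα, rfl, rfl, hne⟩, ⟨β, hβ, hn, rfl, hb.ne'⟩⟩
  have drop : ∀ x, RR Φ s 2 ⟪α, α⟫ (s α) (s β) x →
      x ∈ Submodule.span ℝ ({z | z ∈ Φ ∧ ⟪ω, z⟫ = s z} \ {x}) →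
      x ∈ Submodule.span ℝ
      (({z | z ∈ {z | RR Φ s 2 ⟪α, α⟫ (s α) (s β) z ∧ ⟪z, z⟫ = ⟪α, α⟫} ∧ ⟪ω, z⟫ = s α} ∪
        {z | z ∈ {z | RR Φ s 2 ⟪α, α⟫ (s α) (s β) z ∧ ⟪z, z⟫ = 2 * ⟪α, α⟫} ∧
          ⟪ω, z⟫ = s β}) \ {x}) := by
    intro x hx hmem
    have orth : ∀ z, RR Φ s 2 ⟪α, α⟫ (s α) (s β) z →
        ∀ r ∈ {r | r ∈ Φ ∧ ¬ RR Φ s 2 ⟪α, α⟫ (s α) (s β) r}, ⟪z, r⟫ = 0 := by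
      rintro z hz r ⟨hr, hnr⟩
      by_contra h
      exact hnr (hΦ.rr_step hinv hz hr h)
    refine TwoLen.span_drop (R := {r | r ∈ Φ ∧ ¬ RR Φ s 2 ⟪α, α⟫ (s α) (s β) r}) ?_
      (orth x hx) (Submodule.span_mono ?_ hmem)
    · rintro z ⟨hz | hz, -⟩
      · exact orth z hz.1.1
      · exact orth z hz.1.1
    · rintro z ⟨⟨hz, hωz⟩, hzx⟩
      by_cases hR : RR Φ s 2 ⟪α, α⟫ (s α) (s β) z
      · left
        refine ⟨?_, hzx⟩
        rcases hΦ.wit_norm ha (Or.inl rfl) hz hR.2.1 hR.2.2 with h | h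
        · exact Or.inl ⟨⟨hR, h⟩, hωz.trans (hΦ.wit_s hinv hz hR.2.1 h)⟩
        · exact Or.inr ⟨⟨hR, h⟩, hωz.trans (hΦ.wit_s hinv hz hR.2.2 h)⟩
      · exact Or.inr ⟨hz, hR⟩
  rcases T.main (x := α) (b := β) ⟨Rα, rfl⟩ hωα ⟨Rβ, hn⟩ hωβ hαβ with h | h
  · exact Or.inl fun h' => h (drop α Rα h')
  · exact Or.inr fun h' => h (drop β Rβ h')

end IsRootSystem

end RootPart2

section RootPart3

variable {V : Type*} [NormedAddCommGroup V] [InnerProductSpace ℝ V] {Φ : Finset V}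

namespace IsRootSystem

/-- In the ratio three case both roots are orthogonal to all the other elements. -/
theorem ratio_three_orth (hΦ : IsRootSystem Φ) {ω : V} (hω : ∀ α ∈ Φ, ⟪ω, α⟫ ≠ 0) {s : V → ℝ}
    (hpos : ∀ α ∈ Φ, 0 < s α)
    (hinv : ∀ α ∈ Φ, ∀ β ∈ Φ, s (sRefl β α) = s α) {α β γ : V} (hα : α ∈ Φ) (hβ : β ∈ Φ)
    (hωα : ⟪ω, α⟫ = s α) (hωβ : ⟪ω, β⟫ = s β) (hn : ⟪β, β⟫ = 3 * ⟪α, α⟫)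
    (hαβ : ⟪α, β⟫ = 3 * ⟪α, α⟫ / 2) (hγ : γ ∈ Φ) (hωγ : ⟪ω, γ⟫ = s γ)
    (hγα : γ ≠ α) (hγβ : γ ≠ β) : ⟪α, γ⟫ = 0 ∧ ⟪β, γ⟫ = 0 := by
  have ha := hΦ.ipos hα
  have hb := hΦ.ipos hβ
  have hne : ⟪α, β⟫ ≠ 0 := by rw [hαβ]; positivity
  by_contra hcon
  have Rα : RR Φ s 3 ⟪α, α⟫ (s α) (s β) α :=
    ⟨hα, ⟨α, hα, rfl, rfl, ha.ne'⟩, ⟨β, hβ, hn, rfl, by rwa [real_inner_comm]⟩⟩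
  have Rβ : RR Φ s 3 ⟪α, α⟫ (s α) (s β) β :=
    ⟨hβ, ⟨α, hα, rfl, rfl, hne⟩, ⟨β, hβ, hn, rfl, hb.ne'⟩⟩
  have Rγ : RR Φ s 3 ⟪α, α⟫ (s α) (s β) γ := by
    by_cases h1 : ⟪α, γ⟫ = 0
    · by_cases h2 : ⟪β, γ⟫ = 0
      · exact absurd ⟨h1, h2⟩ hcon
      · exact hΦ.rr_step hinv Rβ hγ h2
    · exact hΦ.rr_step hinv Rα hγ h1
  have m1 : β - (3 : ℝ) • α ∈ Φ := by
    have h := hΦ.refl_mem α hα β hβ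
    have e : 2 * ⟪β, α⟫ / ⟪α, α⟫ = 3 := by rw [real_inner_comm, hαβ]; field_simp
    unfold sRefl at h
    rwa [e] at h
  have m2 : α - β ∈ Φ := by
    have h := hΦ.refl_mem β hβ α hα
    have e : 2 * ⟪α, β⟫ / ⟪β, β⟫ = 1 := by rw [hαβ, hn]; field_simp
    unfold sRefl at h
    rwa [e, one_smul] at h
  have hβα : ⟪β, α⟫ = 3 * ⟪α, α⟫ / 2 := by rw [real_inner_comm, hαβ]
  have c1 := cs (β - (2 : ℝ) • α) γ
  have c2 := cs (β - α) γ
  have c3 := cs ((3 : ℝ) • α - β) γ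
  have w1 := hω _ m1
  have w2 := hω _ m2
  have w3 := hω α hα
  have w4 := hω β hβ
  simp only [inner_sub_left, inner_sub_right, real_inner_smul_left, real_inner_smul_right,
    hαβ, hβα, hn] at c1 c2 c3 w1 w2
  rcases hΦ.wit_norm ha (Or.inr rfl) hγ Rγ.2.1 Rγ.2.2 with hg | hg
  · have hs : s γ = s α := hΦ.wit_s hinv hγ Rγ.2.1 hg
    have o1 := hΦ.obt hω hpos hinv hα hγ hg hγα.symm hωα hωγ
    have o2 := hΦ.v23 hγ hβ (k := 3) (by norm_num) (by rw [hn, hg])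
    rw [hg, real_inner_comm] at o2
    rw [hg] at c1 c2 c3
    rcases o1 with o1 | o1 <;> rcases o2 with o2 | o2 | o2
    · exact hcon ⟨o1, o2⟩
    · rw [o1, o2] at c1; nlinarith
    · rw [o1, o2] at c1; nlinarith
    · have e : γ = β - (2 : ℝ) • α := TwoLen.vec_eq_of (by
        simp only [inner_sub_left, inner_sub_right, real_inner_smul_left, real_inner_smul_right,
          hαβ, hβα, hn, hg, real_inner_comm α γ, real_inner_comm β γ, o1, o2]; ring)
      have : ⟪ω, γ⟫ = ⟪ω, β⟫ - 2 * ⟪ω, α⟫ := by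
        rw [e, inner_sub_right, real_inner_smul_right]
      exact w1 (by linarith)
    · rw [o1, o2] at c2; nlinarith
    · have e : γ = α - β := TwoLen.vec_eq_of (by
        simp only [inner_sub_left, inner_sub_right,
          hαβ, hβα, hn, hg, real_inner_comm α γ, real_inner_comm β γ, o1, o2]; ring)
      have : ⟪ω, γ⟫ = ⟪ω, α⟫ - ⟪ω, β⟫ := by
        rw [e, inner_sub_right]
      exact w4 (by linarith)
  · have hs : s γ = s β := hΦ.wit_s hinv hγ Rγ.2.2 hg
    have o1 := hΦ.obt hω hpos hinv hβ hγ (by rw [hg, hn]) hγβ.symm hωβ hωγ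
    have o2 := hΦ.v23 hα hγ (k := 3) (by norm_num) hg
    rw [hn] at o1
    rw [hg] at c1 c2 c3
    rcases o1 with o1 | o1 <;> rcases o2 with o2 | o2 | o2
    · exact hcon ⟨o2, o1⟩
    · rw [o1, o2] at c3; nlinarith
    · rw [o1, o2] at c3; nlinarith
    · have e : γ = (3 : ℝ) • α - (2 : ℝ) • β := TwoLen.vec_eq_of (by
        simp only [inner_sub_left, inner_sub_right, real_inner_smul_left, real_inner_smul_right,
          hαβ, hβα, hn, hg, real_inner_comm α γ, real_inner_comm β γ, o1, o2]; ring)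
      have : ⟪ω, γ⟫ = 3 * ⟪ω, α⟫ - 2 * ⟪ω, β⟫ := by
        rw [e, inner_sub_right, real_inner_smul_right, real_inner_smul_right]
      exact w2 (by linarith)
    · rw [o1, o2] at c3; nlinarith
    · have e : γ = β - (3 : ℝ) • α := TwoLen.vec_eq_of (by
        simp only [inner_sub_left, inner_sub_right, real_inner_smul_left, real_inner_smul_right,
          hαβ, hβα, hn, hg, real_inner_comm α γ, real_inner_comm β γ, o1, o2]; ring)
      have : ⟪ω, γ⟫ = ⟪ω, β⟫ - 3 * ⟪ω, α⟫ := by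
        rw [e, inner_sub_right, real_inner_smul_right]
      exact w3 (by linarith)

theorem ratio_three (hΦ : IsRootSystem Φ) {ω : V} (hω : ∀ α ∈ Φ, ⟪ω, α⟫ ≠ 0) {s : V → ℝ}
    (hpos : ∀ α ∈ Φ, 0 < s α)
    (hinv : ∀ α ∈ Φ, ∀ β ∈ Φ, s (sRefl β α) = s α) {α β : V} (hα : α ∈ Φ) (hβ : β ∈ Φ)
    (hωα : ⟪ω, α⟫ = s α) (hωβ : ⟪ω, β⟫ = s β) (hn : ⟪β, β⟫ = 3 * ⟪α, α⟫)
    (hαβ : ⟪α, β⟫ = 3 * ⟪α, α⟫ / 2) :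
    α ∉ Submodule.span ℝ ({z | z ∈ Φ ∧ ⟪ω, z⟫ = s z} \ {α}) := by
  intro hmem
  have ha := hΦ.ipos hα
  have key := fun γ => hΦ.ratio_three_orth hω hpos hinv (γ := γ) hα hβ hωα hωβ hn hαβ
  have h : α ∈ Submodule.span ℝ {β} := by
    refine TwoLen.span_drop (R := {z | z ∈ Φ ∧ ⟪ω, z⟫ = s z ∧ z ≠ α ∧ z ≠ β}) ?_ ?_
      (Submodule.span_mono ?_ hmem)
    · rintro _ rfl r ⟨h1, h2, h3, h4⟩
      exact (key r h1 h2 h3 h4).2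
    · rintro r ⟨h1, h2, h3, h4⟩
      exact (key r h1 h2 h3 h4).1
    · rintro z ⟨⟨h1, h2⟩, h3⟩
      by_cases h4 : z = β
      · exact Or.inl h4
      · exact Or.inr ⟨h1, h2, h3, h4⟩
  obtain ⟨c, hc⟩ := Submodule.mem_span_singleton.1 h
  have h1 : c * (3 * ⟪α, α⟫) = 3 * ⟪α, α⟫ / 2 := by
    rw [← hn, ← real_inner_smul_left, hc, hαβ, hn]
  rcases hΦ.reduced β hβ c (by rw [hc]; exact hα) with rfl | rfl <;> linarith

theorem acute (hΦ : IsRootSystem Φ) {ω : V} (hω : ∀ α ∈ Φ, ⟪ω, α⟫ ≠ 0) {s : V → ℝ}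
    (hpos : ∀ α ∈ Φ, 0 < s α)
    (hinv : ∀ α ∈ Φ, ∀ β ∈ Φ, s (sRefl β α) = s α) {α β : V} (hα : α ∈ Φ) (hβ : β ∈ Φ)
    (hωα : ⟪ω, α⟫ = s α) (hωβ : ⟪ω, β⟫ = s β) (hne : α ≠ β)
    (hαβ : 0 < ⟪α, β⟫) :
    α ∉ Submodule.span ℝ ({z | z ∈ Φ ∧ ⟪ω, z⟫ = s z} \ {α}) ∨
    β ∉ Submodule.span ℝ ({z | z ∈ Φ ∧ ⟪ω, z⟫ = s z} \ {β}) := by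
  have ha := hΦ.ipos hα
  have hb := hΦ.ipos hβ
  have hβα : 0 < ⟪β, α⟫ := by rwa [real_inner_comm]
  rcases hΦ.ratio hα hβ hαβ.ne' with h | h | h | h | h
  · exfalso
    rcases hΦ.obt hω hpos hinv hα hβ h hne hωα hωβ with g | g <;> linarith
  · refine hΦ.ratio_two hω hpos hinv hα hβ hωα hωβ h ?_
    rcases hΦ.v23 hα hβ (k := 2) (by norm_num) h with g | g | g <;> linarith
  · refine Or.inl (hΦ.ratio_three hω hpos hinv hα hβ hωα hωβ h ?_)
    rcases hΦ.v23 hα hβ (k := 3) (by norm_num) h with g | g | g <;> linarith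
  · refine (hΦ.ratio_two hω hpos hinv hβ hα hωβ hωα h ?_).symm
    rcases hΦ.v23 hβ hα (k := 2) (by norm_num) h with g | g | g <;> linarith
  · refine Or.inr (hΦ.ratio_three hω hpos hinv hβ hα hωβ hωα h ?_)
    rcases hΦ.v23 hβ hα (k := 3) (by norm_num) h with g | g | g <;> linarith

end IsRootSystem

/-- Linear independence from the acute-pair criterion. -/
theorem linInd_of_acute {S : Set V} {ω : V}
    (hω : ∀ x ∈ S, 0 < ⟪ω, x⟫)
    (hac : ∀ x ∈ S, ∀ y ∈ S, x ≠ y → 0 < ⟪x, y⟫ →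
      x ∉ Submodule.span ℝ (S \ {x}) ∨ y ∉ Submodule.span ℝ (S \ {y})) :
    LinearIndependent ℝ (fun x : S => (x : V)) := by
  classical
  rw [linearIndependent_iff']
  intro t g hg
  have hspan : ∀ i ∈ t, g i ≠ 0 → (i : V) ∈ Submodule.span ℝ (S \ {(i : V)}) := by
    intro i hi hgi
    rw [← Finset.add_sum_erase t _ hi] at hg
    have e : (i : V) = (-(g i)⁻¹) • ∑ j ∈ t.erase i, g j • (j : V) := by
      rw [← neg_eq_of_add_eq_zero_right hg, smul_neg, neg_smul, neg_neg, smul_smul,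
        inv_mul_cancel₀ hgi, one_smul]
    suffices m : (-(g i)⁻¹) • ∑ j ∈ t.erase i, g j • (j : V) ∈
        Submodule.span ℝ (S \ {(i : V)}) by
      rwa [← e] at m
    refine Submodule.smul_mem _ _ (Submodule.sum_mem _ fun j hj => Submodule.smul_mem _ _
      (Submodule.subset_span ⟨j.2, ?_⟩))
    intro h
    exact (Finset.ne_of_mem_erase hj) (Subtype.ext h)
  have hpair : ∀ i ∈ t, ∀ j ∈ t, 0 < g i → g j < 0 → ⟪(i : V), (j : V)⟫ ≤ 0 := by
    intro i hi j hj hgi hgj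
    by_contra hcon
    push Not at hcon
    have hij : (i : V) ≠ j := by
      intro h
      have : i = j := Subtype.ext h
      subst this; linarith
    rcases hac i i.2 j j.2 hij hcon with h | h
    · exact h (hspan i hi hgi.ne')
    · exact h (hspan j hj hgj.ne)
  set v : V := ∑ i ∈ t, (max (g i) 0) • (i : V) with hv
  have hv' : v = ∑ i ∈ t, (max (-g i) 0) • (i : V) := by
    rw [hv, ← sub_eq_zero, ← Finset.sum_sub_distrib, ← hg]
    refine Finset.sum_congr rfl fun i _ => ?_
    rw [← sub_smul]
    congr 1
    rcases le_total (g i) 0 with h | h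
    · rw [max_eq_right h, max_eq_left (by linarith)]; ring
    · rw [max_eq_left h, max_eq_right (by linarith)]; ring
  have hvv : ⟪v, v⟫ ≤ 0 := by
    nth_rewrite 2 [hv']
    rw [hv, sum_inner]
    refine Finset.sum_nonpos fun i hi => ?_
    rw [inner_sum]
    refine Finset.sum_nonpos fun j hj => ?_
    rw [real_inner_smul_left, real_inner_smul_right]
    rcases le_or_gt (g i) 0 with h | h
    · rw [max_eq_right h]; simp
    · rcases le_or_gt 0 (g j) with h' | h'
      · rw [max_eq_right (a := -g j) (by linarith)]; simp
      · have := hpair i hi j hj h h'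
        rw [max_eq_left h.le, max_eq_left (a := -g j) (by linarith)]
        have h1 : 0 < g i * -g j := mul_pos h (by linarith)
        nlinarith
  have hv0 : v = 0 := inner_self_eq_zero.1 (le_antisymm hvv real_inner_self_nonneg)
  have fin : ∀ f : S → ℝ, (∀ i, 0 ≤ f i) → ∑ i ∈ t, f i • (i : V) = 0 → ∀ i ∈ t, f i = 0 := by
    intro f hf h i hi
    have h1 : ∑ i ∈ t, f i * ⟪ω, (i : V)⟫ = 0 := by
      have : ⟪ω, ∑ i ∈ t, f i • (i : V)⟫ = 0 := by rw [h, inner_zero_right]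
      rw [inner_sum] at this
      simpa only [real_inner_smul_right] using this
    have h2 := (Finset.sum_eq_zero_iff_of_nonneg
      (fun i _ => mul_nonneg (hf i) (hω i i.2).le)).1 h1 i hi
    exact (mul_eq_zero.1 h2).resolve_right (hω i i.2).ne'
  intro i hi
  have p1 := fin (fun i => max (g i) 0) (fun i => le_max_right _ _) (hv ▸ hv0) i hi
  have p2 := fin (fun i => max (-g i) 0) (fun i => le_max_right _ _) (hv' ▸ hv0) i hi
  have q1 : g i ≤ max (g i) 0 := le_max_left _ _
  have q2 : -g i ≤ max (-g i) 0 := le_max_left _ _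
  linarith

end RootPart3

/-- Linear independence of the reducibility set: if `s` is a Weyl-invariant positive function
on `Φ` and `ω` is regular, then `S⁺ = {α ∈ Φ : ⟪ω, α⟫ = s(α)}` is linearly independent. -/
theorem statement6 {V : Type*} [NormedAddCommGroup V] [InnerProductSpace ℝ V]
    [FiniteDimensional ℝ V]
    (Φ : Finset V) (hΦ : IsRootSystem Φ)
    (ω : V) (hω : ∀ α ∈ Φ, ⟪ω, α⟫ ≠ 0)
    (s : V → ℝ) (hpos : ∀ α ∈ Φ, 0 < s α)
    (hinv : ∀ α ∈ Φ, ∀ β ∈ Φ, s (sRefl β α) = s α) :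
    LinearIndependent ℝ
      (fun x : {α : V | α ∈ Φ ∧ ⟪ω, α⟫ = s α} => (x : V)) := by
  exact linInd_of_acute (ω := ω) (fun x hx => by rw [hx.2]; exact hpos x hx.1)
    (fun x hx y hy hne h => hΦ.acute hω hpos hinv hx.1 hy.1 hx.2 hy.2 hne h)
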